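/- For every prime p > 7 with p ≠ 13 and p ≠ 19, the number 2^5 · 7^{⌊(p−1)/6⌋} · p is a primitive covering number. -/

import Mathlib

/-- A positive integer `n` is a *covering number* if there is a finite system of
residue classes `aᵢ (mod mᵢ)` covering all of `ℤ`, whose moduli `mᵢ` are distinct,
all greater than `1`, and all divide `n`. -/
def IsCoveringNumber (n : ℕ) : Prop :=
  ∃ (k : ℕ) (a : Fin k → ℤ) (m : Fin k → ℕ),
    Function.Injective m ∧
    (∀ i, 1 < m i) ∧ (∀ i, m i ∣ n) ∧
    (∀ x : ℤ, ∃ i, (m i : ℤ) ∣ x - a i)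

/-- A covering number is *primitive* if none of its proper divisors is a covering number. -/
def IsPrimitiveCoveringNumber (n : ℕ) : Prop :=
  IsCoveringNumber n ∧ ∀ d : ℕ, d ∣ n → d ≠ n → ¬ IsCoveringNumber d

theorem IsCoveringNumber.of_dvd {d n : ℕ} (h : d ∣ n) (hd : IsCoveringNumber d) :
    IsCoveringNumber n := by
  obtain ⟨k, a, m, hm, h1, hdvd, hc⟩ := hd
  exact ⟨k, a, m, hm, h1, fun i => (hdvd i).trans h, hc⟩

/-- A cover with distinct moduli is a choice of one residue class for each divisor. -/
theorem isCoveringNumber_iff {n : ℕ} (hn : n ≠ 0) :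
    IsCoveringNumber n ↔
      ∃ a : ℕ → ℤ, ∀ x : ℤ, ∃ m : ℕ, 1 < m ∧ m ∣ n ∧ (m : ℤ) ∣ x - a m := by
  constructor
  · rintro ⟨k, a, m, hm, h1, hdvd, hc⟩
    refine ⟨Function.extend m a 0, fun x => ?_⟩
    obtain ⟨i, hi⟩ := hc x
    exact ⟨m i, h1 i, hdvd i, by rwa [hm.extend_apply]⟩
  · rintro ⟨a, ha⟩
    let s := n.divisors.filter (1 < ·)
    have hs : ∀ i, (s.equivFin.symm i : ℕ) ∈ s := fun i => (s.equivFin.symm i).2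
    simp only [s, Finset.mem_filter, Nat.mem_divisors] at hs
    refine ⟨s.card, fun i => a (s.equivFin.symm i), fun i => (s.equivFin.symm i : ℕ),
      Subtype.val_injective.comp s.equivFin.symm.injective,
      fun i => (hs i).2, fun i => (hs i).1.1, fun x => ?_⟩
    obtain ⟨m, h1, hdvd, hm⟩ := ha x
    have hmem : m ∈ s := by simp [s, h1, hdvd, hn]
    exact ⟨s.equivFin ⟨m, hmem⟩, by simpa using hm⟩

theorem not_isCoveringNumber_one : ¬ IsCoveringNumber 1 := by
  rw [isCoveringNumber_iff one_ne_zero]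
  rintro ⟨a, ha⟩
  obtain ⟨m, h1, hdvd, -⟩ := ha 0
  have := Nat.dvd_one.1 hdvd
  omega

/-- If `n` is not a covering number and fewer than `q` divisors of `n * q` fail to divide `n`,
then `n * q` is not a covering number. -/
theorem not_isCoveringNumber_mul_prime {n q : ℕ} (hn : n ≠ 0) (hq : q.Prime)
    (hcov : ¬ IsCoveringNumber n) (hcard : ((n * q).divisors \ n.divisors).card < q) :
    ¬ IsCoveringNumber (n * q) := by
  rw [isCoveringNumber_iff (mul_ne_zero hn hq.ne_zero)]
  rintro ⟨a, ha⟩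
  apply hcov
  rw [isCoveringNumber_iff hn]
  by_contra! hU
  obtain ⟨x, hx⟩ := hU a
  choose f hf1 hfdvd hf using fun t : ℕ => ha (x + n * t)
  have hnew : ∀ t, ¬ f t ∣ n := fun t ht => by
    refine hx (f t) (hf1 t) ht ?_
    have h1 : (f t : ℤ) ∣ n * t := (Int.natCast_dvd_natCast.2 ht).mul_right _
    have h2 := dvd_sub (hf t) h1
    rwa [show x + n * t - a (f t) - n * t = x - a (f t) by ring] at h2
  have hmaps : Set.MapsTo f (Finset.range q) ((n * q).divisors \ n.divisors : Finset ℕ) := by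
    intro t _
    simp [hfdvd t, hnew t, hn, hq.ne_zero]
  obtain ⟨t, ht, u, hu, htu, hfe⟩ :=
    Finset.exists_ne_map_eq_of_card_lt_of_maps_to (by simpa using hcard) hmaps
  have hdiff : (f t : ℤ) ∣ n * (t - u) := by
    have hu' := hf u
    rw [← hfe] at hu'
    have h := dvd_sub (hf t) hu'
    rwa [show x + n * t - a (f t) - (x + n * u - a (f t)) = (n : ℤ) * (t - u) by ring] at h
  have hndvd : ¬ (q : ℤ) ∣ t - u := by
    intro h
    simp only [Finset.mem_range] at ht hu
    have := Int.eq_zero_of_abs_lt_dvd h (by rw [abs_lt]; omega)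
    omega
  have hcop : IsCoprime (q : ℤ) (t - u) :=
    (Prime.coprime_iff_not_dvd (Nat.prime_iff_prime_int.1 hq)).2 hndvd
  obtain ⟨c, d, hcd⟩ := hcop
  apply hnew t
  have h1 : (f t : ℤ) ∣ n * q := by exact_mod_cast hfdvd t
  have h2 : (f t : ℤ) ∣ c * (n * q) + d * (n * (t - u)) :=
    dvd_add (h1.mul_left _) (hdiff.mul_left _)
  rw [show c * (n * q) + d * (n * (t - u)) = (n : ℤ) * (c * q + d * (t - u)) by ring, hcd,
    mul_one] at h2
  exact_mod_cast h2

/-- One residue class for each divisor of `n` greater than `1` suffices to cover every integer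
that is not a multiple of `n`. -/
def CoversNonmultiples (n : ℕ) : Prop :=
  ∃ a : ℕ → ℤ, ∀ x : ℤ, (n : ℤ) ∣ x ∨ ∃ m : ℕ, 1 < m ∧ m ∣ n ∧ (m : ℤ) ∣ x - a m

theorem coversNonmultiples_one : CoversNonmultiples 1 :=
  ⟨0, fun x => Or.inl (by simp)⟩

/-- The divisors of `n * q` not dividing `n` can be used to cover the multiples `n * y` of `n`
with `y` in prescribed residue classes modulo `q`. -/
theorem CoversNonmultiples.exists_extension {n : ℕ} (h : CoversNonmultiples n) (q : ℕ)
    (t : ℕ → ℤ) :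
    ∃ a : ℕ → ℤ, ∀ x : ℤ, (∃ m : ℕ, 1 < m ∧ m ∣ n * q ∧ (m : ℤ) ∣ x - a m) ∨
      ∃ y : ℤ, x = n * y ∧
        ∀ m ∈ (n * q).divisors \ n.divisors, ¬ (q : ℤ) ∣ y - t m := by
  obtain ⟨a, ha⟩ := h
  refine ⟨fun m => if m ∣ n then a m else n * t m, fun x => ?_⟩
  rcases ha x with ⟨y, rfl⟩ | ⟨m, h1, hmn, hm⟩
  · by_cases hex : ∃ m ∈ (n * q).divisors \ n.divisors, (q : ℤ) ∣ y - t m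
    · obtain ⟨m, hmem, hqy⟩ := hex
      simp only [Finset.mem_sdiff, Nat.mem_divisors, ne_eq, not_and, not_not] at hmem
      obtain ⟨⟨hmnq, hnq⟩, hmn⟩ := hmem
      have hn : n ≠ 0 := left_ne_zero_of_mul hnq
      have hmn' : ¬ m ∣ n := fun hd => hn (hmn hd)
      have hm0 : m ≠ 0 := by rintro rfl; exact hnq (Nat.eq_zero_of_zero_dvd hmnq)
      have hm1 : m ≠ 1 := by rintro rfl; exact hmn' (one_dvd n)
      refine Or.inl ⟨m, by omega, hmnq, ?_⟩
      beta_reduce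
      rw [if_neg hmn', ← mul_sub]
      have hmnq' : (m : ℤ) ∣ n * q := by exact_mod_cast hmnq
      exact hmnq'.trans (mul_dvd_mul_left _ hqy)
    · push Not at hex
      exact Or.inr ⟨y, rfl, hex⟩
  · exact Or.inl ⟨m, h1, hmn.mul_right q, by simpa only [if_pos hmn] using hm⟩

theorem Finset.exists_nat_valued_map_onto {α : Type*} (s : Finset α) :
    ∃ t : α → ℕ, ∀ c < s.card, ∃ m ∈ s, t m = c := by
  classical
  refine ⟨fun m => if h : m ∈ s then s.equivFin ⟨m, h⟩ else 0, fun c hc => ?_⟩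
  exact ⟨s.equivFin.symm ⟨c, hc⟩, (s.equivFin.symm ⟨c, hc⟩).2, by simp⟩

theorem CoversNonmultiples.mul {n q : ℕ} (h : CoversNonmultiples n) (hq : 0 < q)
    (hcard : q ≤ ((n * q).divisors \ n.divisors).card + 1) : CoversNonmultiples (n * q) := by
  obtain ⟨t, ht⟩ := ((n * q).divisors \ n.divisors).exists_nat_valued_map_onto
  obtain ⟨a, ha⟩ := h.exists_extension q (fun m => t m + 1)
  refine ⟨a, fun x => ?_⟩
  rcases ha x with hx | ⟨y, rfl, hy⟩
  · exact Or.inr hx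
  · left
    push_cast
    apply mul_dvd_mul_left
    by_contra hndvd
    have hpos : y % q ≠ 0 := fun h0 => hndvd (Int.dvd_of_emod_eq_zero h0)
    have hnn := Int.emod_nonneg y (by omega : (q : ℤ) ≠ 0)
    have hlt := Int.emod_lt_of_pos y (by omega : (0 : ℤ) < q)
    obtain ⟨m, hm, htm⟩ := ht ((y % q).toNat - 1) (by omega)
    refine hy m hm ?_
    rw [show (t m : ℤ) + 1 = y % q by omega]
    exact Int.dvd_self_sub_emod

theorem CoversNonmultiples.isCoveringNumber_mul {n q : ℕ} (h : CoversNonmultiples n)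
    (hn : n ≠ 0) (hq : 0 < q) (hcard : q ≤ ((n * q).divisors \ n.divisors).card) :
    IsCoveringNumber (n * q) := by
  obtain ⟨t, ht⟩ := ((n * q).divisors \ n.divisors).exists_nat_valued_map_onto
  obtain ⟨a, ha⟩ := h.exists_extension q (fun m => t m)
  rw [isCoveringNumber_iff (mul_ne_zero hn hq.ne')]
  refine ⟨a, fun x => ?_⟩
  rcases ha x with hx | ⟨y, rfl, hy⟩
  · exact hx
  · have hnn := Int.emod_nonneg y (by omega : (q : ℤ) ≠ 0)
    have hlt := Int.emod_lt_of_pos y (by omega : (0 : ℤ) < q)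
    obtain ⟨m, hm, htm⟩ := ht (y % q).toNat (by omega)
    refine absurd ?_ (hy m hm)
    rw [show (t m : ℤ) = y % q by omega]
    exact Int.dvd_self_sub_emod

theorem card_divisors_mul_prime_pow {n q : ℕ} (hq : q.Prime) (hnq : n.Coprime q) (b : ℕ) :
    (n * q ^ b).divisors.card = n.divisors.card * (b + 1) := by
  rw [(hnq.pow_right b).card_divisors_mul, Nat.divisors_prime_pow hq]
  simp

theorem card_divisors_sdiff_mul_prime_pow {n q : ℕ} (hn : n ≠ 0) (hq : q.Prime)
    (hnq : n.Coprime q) (b : ℕ) :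
    ((n * q ^ b * q).divisors \ (n * q ^ b).divisors).card = n.divisors.card := by
  have hsub : (n * q ^ b).divisors ⊆ (n * q ^ b * q).divisors :=
    Nat.divisors_subset_of_dvd (by simp [hn, hq.ne_zero]) (dvd_mul_right _ _)
  rw [Finset.card_sdiff_of_subset hsub, mul_assoc, ← pow_succ,
    card_divisors_mul_prime_pow hq hnq, card_divisors_mul_prime_pow hq hnq, ← Nat.mul_sub]
  simp

theorem card_divisors_sdiff_mul_prime {n q : ℕ} (hn : n ≠ 0) (hq : q.Prime)
    (hnq : n.Coprime q) : ((n * q).divisors \ n.divisors).card = n.divisors.card := by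
  simpa using card_divisors_sdiff_mul_prime_pow hn hq hnq 0

theorem not_isCoveringNumber_mul_prime_pow {n q : ℕ} (hn : n ≠ 0) (hq : q.Prime)
    (hnq : n.Coprime q) (hcov : ¬ IsCoveringNumber n) (hcard : n.divisors.card < q) (b : ℕ) :
    ¬ IsCoveringNumber (n * q ^ b) := by
  induction b with
  | zero => simpa using hcov
  | succ b ih =>
    rw [pow_succ, ← mul_assoc]
    refine not_isCoveringNumber_mul_prime (by simp [hn, hq.ne_zero]) hq ih ?_
    rwa [card_divisors_sdiff_mul_prime_pow hn hq hnq]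

theorem CoversNonmultiples.mul_prime_pow {n q : ℕ} (h : CoversNonmultiples n) (hn : n ≠ 0)
    (hq : q.Prime) (hnq : n.Coprime q) (hcard : q ≤ n.divisors.card + 1) (b : ℕ) :
    CoversNonmultiples (n * q ^ b) := by
  induction b with
  | zero => simpa using h
  | succ b ih =>
    rw [pow_succ, ← mul_assoc]
    refine ih.mul hq.pos ?_
    rwa [card_divisors_sdiff_mul_prime_pow hn hq hnq]

theorem card_divisors_two_pow (a : ℕ) : (2 ^ a).divisors.card = a + 1 := by
  simp [Nat.divisors_prime_pow Nat.prime_two]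

theorem coprime_two_pow_seven (a : ℕ) : (2 ^ a).Coprime 7 :=
  Nat.Coprime.pow_left a (by norm_num)

theorem card_divisors_two_pow_mul_seven_pow (a b : ℕ) :
    (2 ^ a * 7 ^ b).divisors.card = (a + 1) * (b + 1) := by
  rw [card_divisors_mul_prime_pow (by norm_num) (coprime_two_pow_seven a),
    card_divisors_two_pow]

theorem coprime_two_pow_mul_seven_pow {p : ℕ} (hp : p.Prime) (h7 : 7 < p) (a b : ℕ) :
    (2 ^ a * 7 ^ b).Coprime p :=
  .mul_left (.pow_left a ((Nat.coprime_primes Nat.prime_two hp).2 (by omega)))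
    (.pow_left b ((Nat.coprime_primes (by norm_num) hp).2 (by omega)))

theorem not_isCoveringNumber_two_pow (a : ℕ) : ¬ IsCoveringNumber (2 ^ a) := by
  simpa using not_isCoveringNumber_mul_prime_pow one_ne_zero Nat.prime_two (by simp)
    not_isCoveringNumber_one (by simp) a

theorem not_isCoveringNumber_two_pow_mul_seven_pow {a : ℕ} (ha : a ≤ 5) (b : ℕ) :
    ¬ IsCoveringNumber (2 ^ a * 7 ^ b) :=
  not_isCoveringNumber_mul_prime_pow (by positivity) (by norm_num) (coprime_two_pow_seven a)
    (not_isCoveringNumber_two_pow a) (by rw [card_divisors_two_pow]; omega) b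

theorem not_isCoveringNumber_two_pow_mul_seven_pow_mul_prime {p a b : ℕ} (hp : p.Prime)
    (h7 : 7 < p) (ha : a ≤ 5) (hcard : (a + 1) * (b + 1) < p) :
    ¬ IsCoveringNumber (2 ^ a * 7 ^ b * p) := by
  refine not_isCoveringNumber_mul_prime (by positivity) hp
    (not_isCoveringNumber_two_pow_mul_seven_pow ha b) ?_
  rwa [card_divisors_sdiff_mul_prime (by positivity) hp (coprime_two_pow_mul_seven_pow hp h7 a b),
    card_divisors_two_pow_mul_seven_pow]

theorem coversNonmultiples_two_pow (a : ℕ) : CoversNonmultiples (2 ^ a) := by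
  simpa using coversNonmultiples_one.mul_prime_pow one_ne_zero Nat.prime_two (by simp)
    (by simp) a

theorem isCoveringNumber_two_pow_five_mul_seven_pow_mul_prime {p b : ℕ} (hp : p.Prime)
    (h7 : 7 < p) (hcard : p ≤ 6 * (b + 1)) : IsCoveringNumber (2 ^ 5 * 7 ^ b * p) := by
  have h := (coversNonmultiples_two_pow 5).mul_prime_pow (by positivity) (q := 7) (by norm_num)
    (coprime_two_pow_seven 5) (by rw [card_divisors_two_pow]) b
  refine h.isCoveringNumber_mul (by positivity) hp.pos ?_
  rwa [card_divisors_sdiff_mul_prime (by positivity) hp (coprime_two_pow_mul_seven_pow hp h7 5 b),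
    card_divisors_two_pow_mul_seven_pow]

theorem stmt11 (p : ℕ) (hp : p.Prime) (h7 : 7 < p) (h13 : p ≠ 13) (h19 : p ≠ 19) :
    IsPrimitiveCoveringNumber (2 ^ 5 * 7 ^ ((p - 1) / 6) * p) := by
  refine ⟨isCoveringNumber_two_pow_five_mul_seven_pow_mul_prime hp h7 (by omega), ?_⟩
  rintro d ⟨k, hk⟩ hne hd
  obtain ⟨b, hb⟩ : ∃ b, (p - 1) / 6 = b + 1 := ⟨(p - 1) / 6 - 1, by omega⟩
  rw [hb] at hk hne
  have hk1 : k ≠ 1 := by rintro rfl; exact hne (by simpa using hk.symm)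
  obtain ⟨q, hq, j, rfl⟩ := Nat.exists_prime_and_dvd hk1
  have hqn : q ∣ 2 ^ 5 * 7 ^ (b + 1) * p := ⟨d * j, by rw [hk]; ring⟩
  have key : ∀ e, 2 ^ 5 * 7 ^ (b + 1) * p = q * e → IsCoveringNumber e := fun e he =>
    hd.of_dvd ⟨j, Nat.eq_of_mul_eq_mul_left hq.pos (by rw [← he, hk]; ring)⟩
  rcases hq.dvd_mul.1 hqn with hqn | hqp
  · rcases hq.dvd_mul.1 hqn with hq2 | hq7
    · obtain rfl := (Nat.prime_dvd_prime_iff_eq hq Nat.prime_two).1 (hq.dvd_of_dvd_pow hq2)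
      have hcard : (4 + 1) * (b + 1 + 1) < p := by
        by_contra hle
        have hp25 : p ≤ 25 := by omega
        interval_cases p <;> first | omega | (revert hp; norm_num)
      exact not_isCoveringNumber_two_pow_mul_seven_pow_mul_prime hp h7 (by norm_num) hcard
        (key _ (by ring))
    · obtain rfl := (Nat.prime_dvd_prime_iff_eq hq (by norm_num)).1 (hq.dvd_of_dvd_pow hq7)
      exact not_isCoveringNumber_two_pow_mul_seven_pow_mul_prime (a := 5) (b := b) hp h7 le_rfl
        (by omega) (key _ (by ring))
  · obtain rfl := (Nat.prime_dvd_prime_iff_eq hq hp).1 hqp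
    exact not_isCoveringNumber_two_pow_mul_seven_pow le_rfl (b + 1) (key _ (by ring))
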